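/- If f, g, h ∈ L¹(ℝⁿ), then the ℋ-convolution is associative: (f ⋆_ℋ g) ⋆_ℋ h = f ⋆_ℋ (g ⋆_ℋ h) almost everywhere on ℝⁿ. -/

import Mathlib

open MeasureTheory Real Filter

noncomputable def Kab (n : ℕ) (a b : ℝ) (f : (Fin n → ℝ) → ℝ) (x v : Fin n → ℝ) : ℝ :=
  (3 * a ^ 2 - b ^ 2) * f (x - v) +
    (a ^ 2 + b ^ 2) * (f (x + v) + f (-x + v) - f (-x - v))

noncomputable def Hconv (n : ℕ) (a b : ℝ) (f g : (Fin n → ℝ) → ℝ)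
    (x : Fin n → ℝ) : ℝ :=
  (1 / (4 * a * (2 * Real.pi) ^ ((n : ℝ) / 2))) * ∫ v, Kab n a b f x v * g v

open ContinuousLinearMap in
/-- Convolution on `L¹(ℝⁿ)`, as a bilinear map. -/
noncomputable def convL1 (n : ℕ) :
    ((Fin n → ℝ) →₁[volume] ℝ) →ₗ[ℝ] ((Fin n → ℝ) →₁[volume] ℝ) →ₗ[ℝ]
      ((Fin n → ℝ) →₁[volume] ℝ) :=
  LinearMap.mk₂ ℝ
    (fun F G => ((L1.integrable_coeFn F).integrable_convolution (mul ℝ ℝ)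
      (L1.integrable_coeFn G)).toL1 _)
    (fun F F' G => by
      rw [← Integrable.toL1_add, Integrable.toL1_eq_toL1_iff,
        convolution_congr (mul ℝ ℝ) (Lp.coeFn_add F F') (ae_eq_refl G)]
      filter_upwards [(L1.integrable_coeFn F).ae_convolution_exists (mul ℝ ℝ)
        (L1.integrable_coeFn G), (L1.integrable_coeFn F').ae_convolution_exists (mul ℝ ℝ)
        (L1.integrable_coeFn G)] with x h₁ h₂
      exact h₁.add_distrib h₂)
    (fun c F G => by
      rw [← Integrable.toL1_smul, Integrable.toL1_eq_toL1_iff,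
        convolution_congr (mul ℝ ℝ) (Lp.coeFn_smul c F) (ae_eq_refl G), smul_convolution]
      rfl)
    (fun F G G' => by
      rw [← Integrable.toL1_add, Integrable.toL1_eq_toL1_iff,
        convolution_congr (mul ℝ ℝ) (ae_eq_refl F) (Lp.coeFn_add G G')]
      filter_upwards [(L1.integrable_coeFn F).ae_convolution_exists (mul ℝ ℝ)
        (L1.integrable_coeFn G), (L1.integrable_coeFn F).ae_convolution_exists (mul ℝ ℝ)
        (L1.integrable_coeFn G')] with x h₁ h₂
      exact h₁.distrib_add h₂)
    (fun c F G => by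
      rw [← Integrable.toL1_smul, Integrable.toL1_eq_toL1_iff,
        convolution_congr (mul ℝ ℝ) (ae_eq_refl F) (Lp.coeFn_smul c G), convolution_smul]
      rfl)

open ContinuousLinearMap in
theorem coeFn_convL1 {n : ℕ} (F G : (Fin n → ℝ) →₁[volume] ℝ) :
    convL1 n F G =ᵐ[volume] convolution F G (mul ℝ ℝ) volume :=
  ((L1.integrable_coeFn F).integrable_convolution (mul ℝ ℝ) (L1.integrable_coeFn G)).coeFn_toL1

open ContinuousLinearMap in
theorem convL1_assoc {n : ℕ} (F G H : (Fin n → ℝ) →₁[volume] ℝ) :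
    convL1 n (convL1 n F G) H = convL1 n F (convL1 n G H) := by
  have hF := L1.integrable_coeFn F
  have hG := L1.integrable_coeFn G
  have hH := L1.integrable_coeFn H
  refine Lp.ext ?_
  filter_upwards [coeFn_convL1 (convL1 n F G) H, coeFn_convL1 F (convL1 n G H),
    hF.norm.ae_convolution_exists (mul ℝ ℝ)
      (hG.norm.integrable_convolution (mul ℝ ℝ) hH.norm)] with x h₁ h₂ h₃
  rw [h₁, h₂, convolution_congr (mul ℝ ℝ) (coeFn_convL1 F G) (ae_eq_refl H),
    convolution_congr (mul ℝ ℝ) (ae_eq_refl F) (coeFn_convL1 G H)]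
  exact convolution_assoc (mul ℝ ℝ) (mul ℝ ℝ) (mul ℝ ℝ) (mul ℝ ℝ)
    (fun x y z => mul_assoc x y z) hF.aestronglyMeasurable hG.aestronglyMeasurable
    hH.aestronglyMeasurable (hF.ae_convolution_exists (mul ℝ ℝ) hG)
    (hG.norm.ae_convolution_exists (mul ℝ ℝ) hH.norm) h₃

/-- The reflection `f ↦ f ∘ (-·)` on `L¹(ℝⁿ)`. -/
noncomputable def reflL1 (n : ℕ) :
    ((Fin n → ℝ) →₁[volume] ℝ) →ₗ[ℝ] ((Fin n → ℝ) →₁[volume] ℝ) :=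
  Lp.compMeasurePreservingₗ ℝ (fun x => -x) (Measure.measurePreserving_neg volume)

theorem coeFn_reflL1 {n : ℕ} (F : (Fin n → ℝ) →₁[volume] ℝ) :
    reflL1 n F =ᵐ[volume] fun x => F (-x) :=
  Lp.coeFn_compMeasurePreserving F (Measure.measurePreserving_neg volume)

theorem reflL1_reflL1 {n : ℕ} (F : (Fin n → ℝ) →₁[volume] ℝ) : reflL1 n (reflL1 n F) = F := by
  refine Lp.ext ?_
  filter_upwards [coeFn_reflL1 (reflL1 n F),
    (Measure.measurePreserving_neg volume).quasiMeasurePreserving.ae (coeFn_reflL1 F)]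
    with x h₁ h₂
  rw [h₁, h₂, neg_neg]

open ContinuousLinearMap in
theorem reflL1_convL1 {n : ℕ} (F G : (Fin n → ℝ) →₁[volume] ℝ) :
    reflL1 n (convL1 n F G) = convL1 n (reflL1 n F) (reflL1 n G) := by
  refine Lp.ext ?_
  filter_upwards [coeFn_reflL1 (convL1 n F G), coeFn_convL1 (reflL1 n F) (reflL1 n G),
    (Measure.measurePreserving_neg volume).quasiMeasurePreserving.ae (coeFn_convL1 F G)]
    with x h₁ h₂ h₃
  rw [h₁, h₂, h₃, convolution_congr (mul ℝ ℝ) (coeFn_reflL1 F) (coeFn_reflL1 G),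
    convolution_mul, convolution_mul, ← integral_neg_eq_self]
  refine integral_congr_ae (.of_forall fun t => ?_)
  simp only [neg_sub, sub_neg_eq_add]
  congr 2
  abel

/-- The combination `p B(x, y) + q (B(x, Ry) + B(Rx, y) - B(Rx, Ry))`. -/
def reflTwist {M : Type*} [AddCommGroup M] [Module ℝ M] (B : M →ₗ[ℝ] M →ₗ[ℝ] M) (R : M →ₗ[ℝ] M)
    (p q : ℝ) (x y : M) : M :=
  p • B x y + q • (B x (R y) + B (R x) y - B (R x) (R y))

theorem reflTwist_assoc {M : Type*} [AddCommGroup M] [Module ℝ M] (B : M →ₗ[ℝ] M →ₗ[ℝ] M)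
    (R : M →ₗ[ℝ] M) (hR : ∀ x, R (R x) = x) (hRB : ∀ x y, R (B x y) = B (R x) (R y))
    (hB : ∀ x y z, B (B x y) z = B x (B y z)) (p q : ℝ) (x y z : M) :
    reflTwist B R p q (reflTwist B R p q x y) z =
      reflTwist B R p q x (reflTwist B R p q y z) := by
  simp only [reflTwist, map_add, map_sub, map_smul, LinearMap.add_apply, LinearMap.sub_apply,
    LinearMap.smul_apply, hRB, hR, hB]
  module

open ContinuousLinearMap in
theorem hconv_ae_eq {n : ℕ} {a b : ℝ} {f g : (Fin n → ℝ) → ℝ}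
    {F G : (Fin n → ℝ) →₁[volume] ℝ} (hf : f =ᵐ[volume] F) (hg : g =ᵐ[volume] G) :
    Hconv n a b f g =ᵐ[volume] ((1 / (4 * a * (2 * Real.pi) ^ ((n : ℝ) / 2))) •
      reflTwist (convL1 n) (reflL1 n) (3 * a ^ 2 - b ^ 2) (a ^ 2 + b ^ 2) F G :
        (Fin n → ℝ) →₁[volume] ℝ) := by
  have hneg := (Measure.measurePreserving_neg (volume : Measure (Fin n → ℝ))).quasiMeasurePreserving
  have hf' : (fun x => f (-x)) =ᵐ[volume] reflL1 n F :=
    (hneg.ae_eq_comp hf).trans (coeFn_reflL1 F).symm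
  have hg' : (fun x => g (-x)) =ᵐ[volume] reflL1 n G :=
    (hneg.ae_eq_comp hg).trans (coeFn_reflL1 G).symm
  have hfi : Integrable f := (L1.integrable_coeFn F).congr hf.symm
  have hgi : Integrable g := (L1.integrable_coeFn G).congr hg.symm
  have hfi' := hfi.comp_neg
  have hgi' := hgi.comp_neg
  have hT := Lp.coeFn_smul (1 / (4 * a * (2 * Real.pi) ^ ((n : ℝ) / 2)))
    (reflTwist (convL1 n) (reflL1 n) (3 * a ^ 2 - b ^ 2) (a ^ 2 + b ^ 2) F G)
  unfold reflTwist at hT ⊢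
  filter_upwards [hfi.ae_convolution_exists (mul ℝ ℝ) hgi,
    hfi.ae_convolution_exists (mul ℝ ℝ) hgi', hfi'.ae_convolution_exists (mul ℝ ℝ) hgi,
    hfi'.ae_convolution_exists (mul ℝ ℝ) hgi', coeFn_convL1 F G, coeFn_convL1 F (reflL1 n G),
    coeFn_convL1 (reflL1 n F) G, coeFn_convL1 (reflL1 n F) (reflL1 n G), hT,
    Lp.coeFn_add ((3 * a ^ 2 - b ^ 2) • convL1 n F G) ((a ^ 2 + b ^ 2) •
      (convL1 n F (reflL1 n G) + convL1 n (reflL1 n F) G - convL1 n (reflL1 n F) (reflL1 n G))),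
    Lp.coeFn_smul (3 * a ^ 2 - b ^ 2) (convL1 n F G),
    Lp.coeFn_smul (a ^ 2 + b ^ 2)
      (convL1 n F (reflL1 n G) + convL1 n (reflL1 n F) G - convL1 n (reflL1 n F) (reflL1 n G)),
    Lp.coeFn_sub (convL1 n F (reflL1 n G) + convL1 n (reflL1 n F) G)
      (convL1 n (reflL1 n F) (reflL1 n G)),
    Lp.coeFn_add (convL1 n F (reflL1 n G)) (convL1 n (reflL1 n F) G)]
    with x e₁ e₂ e₃ e₄ c₁ c₂ c₃ c₄ s₁ s₂ s₃ s₄ s₅ s₆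
  rw [s₁, Pi.smul_apply, s₂, Pi.add_apply, s₃, s₄, Pi.smul_apply, Pi.smul_apply, s₅, Pi.sub_apply,
    s₆, Pi.add_apply, c₁, c₂, c₃, c₄, ← convolution_congr (mul ℝ ℝ) hf hg,
    ← convolution_congr (mul ℝ ℝ) hf hg', ← convolution_congr (mul ℝ ℝ) hf' hg,
    ← convolution_congr (mul ℝ ℝ) hf' hg']
  simp only [smul_eq_mul, convolution_mul_swap, Hconv, Kab]
  congr 1
  have i₁ : Integrable fun v => f (x - v) * g v := e₁.integrable_swap
  have i₂ : Integrable fun v => f (x + v) * g v := by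
    simpa using e₂.integrable_swap.comp_neg
  have i₃ : Integrable fun v => f (-x + v) * g v := by
    have := e₃.integrable_swap
    simpa [sub_eq_neg_add, add_comm] using this
  have i₄ : Integrable fun v => f (-x - v) * g v := by
    have := e₄.integrable_swap.comp_neg
    simpa [sub_eq_add_neg, add_comm] using this
  have j₂ : ∫ v, f (x - v) * g (-v) = ∫ v, f (x + v) * g v := by
    rw [← integral_neg_eq_self]; simp
  have j₃ : ∫ v, f (-(x - v)) * g v = ∫ v, f (-x + v) * g v := by
    simp [sub_eq_neg_add, add_comm]
  have j₄ : ∫ v, f (-(x - v)) * g (-v) = ∫ v, f (-x - v) * g v := by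
    rw [← integral_neg_eq_self]; simp [sub_eq_add_neg, add_comm]
  have i₅ : Integrable fun v => f (x + v) * g v + f (-x + v) * g v := i₂.add i₃
  have i₆ : Integrable fun v => f (x + v) * g v + f (-x + v) * g v - f (-x - v) * g v := i₅.sub i₄
  rw [j₂, j₃, j₄, ← integral_add i₂ i₃, ← integral_sub i₅ i₄, ← integral_const_mul,
    ← integral_const_mul, ← integral_add (i₁.const_mul _) (i₆.const_mul _)]
  refine integral_congr_ae (.of_forall fun v => ?_)
  simp only
  ring

theorem stmt6 (n : ℕ) (hn : 1 ≤ n) (a b : ℝ) (ha : a ≠ 0)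
    (hab : a ^ 2 + b ^ 2 ≠ 0) (hab1 : a ≠ b) (hab2 : a ≠ -b)
    (f g h : (Fin n → ℝ) → ℝ)
    (hf : Integrable f volume) (hg : Integrable g volume) (hh : Integrable h volume) :
    ∀ᵐ x ∂(volume : Measure (Fin n → ℝ)),
      Hconv n a b (Hconv n a b f g) h x = Hconv n a b f (Hconv n a b g h) x := by
  have hF := hf.coeFn_toL1.symm
  have hG := hg.coeFn_toL1.symm
  have hH := hh.coeFn_toL1.symm
  refine (hconv_ae_eq (hconv_ae_eq hF hG) hH).trans
    (EventuallyEq.trans ?_ (hconv_ae_eq hF (hconv_ae_eq hG hH)).symm)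
  set c := 1 / (4 * a * (2 * Real.pi) ^ ((n : ℝ) / 2))
  have hl (p q : ℝ) (F G : (Fin n → ℝ) →₁[volume] ℝ) :
      reflTwist (convL1 n) (reflL1 n) p q (c • F) G =
        c • reflTwist (convL1 n) (reflL1 n) p q F G := by
    simp only [reflTwist, map_smul, LinearMap.smul_apply]
    module
  have hr (p q : ℝ) (F G : (Fin n → ℝ) →₁[volume] ℝ) :
      reflTwist (convL1 n) (reflL1 n) p q F (c • G) =
        c • reflTwist (convL1 n) (reflL1 n) p q F G := by
    simp only [reflTwist, map_smul]
    module
  rw [hl, hr, reflTwist_assoc _ _ reflL1_reflL1 reflL1_convL1 convL1_assoc]
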